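/- arXiv:1512.04080 — 14 statements merged into one kernel-verified Lean document; each statement's English description precedes it below -/
import Mathlib

section
/- Let n ≥ 1 and let W : ℝⁿ → ℝ be a C¹ function. Let u¹, u² ∈ ℝⁿ and let u : ℝ → ℝⁿ be a C¹ map with u(x) → u¹ as x → −∞ and u(x) → u² as x → +∞, such that the energy density x ↦ ½|u'(x)|² + ½|∇W(u(x))|² is integrable over ℝ. Then the energy E(u) = ∫_ℝ (½|u'(x)|² + ½|∇W(u(x))|²) dx satisfies E(u) ≥ |W(u²) − W(u¹)| (the Bogomol'nyi/BPS bound). -/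
open MeasureTheory Filter

/-- Young's inequality for the derivative of `W` along a vector, in terms of the gradient. -/
lemma abs_fderiv_apply_le_half_sq_add {F : Type*} [NormedAddCommGroup F] [InnerProductSpace ℝ F]
    [CompleteSpace F] (W : F → ℝ) (p v : F) :
    |fderiv ℝ W p v| ≤ (1 / 2) * ‖v‖ ^ 2 + (1 / 2) * ‖gradient W p‖ ^ 2 := by
  rw [← inner_gradient_left]
  have h := abs_real_inner_le_norm (gradient W p) v
  nlinarith [sq_nonneg (‖gradient W p‖ - ‖v‖)]

/-- The Bogomol'nyi/BPS energy lower bound for the domain wall energy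
`E(u) = ∫ (½|u'|² + ½|∇W(u)|²)` of a finite-energy configuration linking `u₁` and `u₂`. -/
theorem bps_energy_bound (n : ℕ) (hn : 1 ≤ n)
    (W : EuclideanSpace ℝ (Fin n) → ℝ) (hW : ContDiff ℝ 1 W)
    (u₁ u₂ : EuclideanSpace ℝ (Fin n))
    (u : ℝ → EuclideanSpace ℝ (Fin n)) (hu : ContDiff ℝ 1 u)
    (hbot : Tendsto u atBot (nhds u₁)) (htop : Tendsto u atTop (nhds u₂))
    (hint : Integrable (fun x : ℝ =>
      (1 / 2) * ‖deriv u x‖ ^ 2 + (1 / 2) * ‖gradient W (u x)‖ ^ 2)) :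
    |W u₂ - W u₁| ≤
      ∫ x : ℝ, ((1 / 2) * ‖deriv u x‖ ^ 2 + (1 / 2) * ‖gradient W (u x)‖ ^ 2) := by
  have hderiv (x : ℝ) : HasDerivAt (fun y => W (u y)) (fderiv ℝ W (u x) (deriv u x)) x :=
    ((hW.differentiable one_ne_zero) (u x)).hasFDerivAt.comp_hasDerivAt x
      ((hu.differentiable one_ne_zero) x).hasDerivAt
  have hbound (x : ℝ) := abs_fderiv_apply_le_half_sq_add W (u x) (deriv u x)
  have hcont : Continuous fun x => fderiv ℝ W (u x) (deriv u x) :=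
    ((hW.continuous_fderiv one_ne_zero).comp hu.continuous).clm_apply
      (hu.continuous_deriv le_rfl)
  have hint' : Integrable fun x => fderiv ℝ W (u x) (deriv u x) :=
    hint.mono' hcont.aestronglyMeasurable (Eventually.of_forall hbound)
  rw [← integral_of_hasDerivAt_of_tendsto hderiv hint'
    ((hW.continuous.tendsto u₁).comp hbot) ((hW.continuous.tendsto u₂).comp htop)]
  rw [← Real.norm_eq_abs]
  exact norm_integral_le_of_norm_le hint (Eventually.of_forall hbound)
end

section
/- Let n ≥ 1 and let W : ℝⁿ → ℝ be C². Let u¹ ∈ ℝⁿ be a critical point of W at which the Hessian matrix (W_{u_i u_j}(u¹)) is negative definite. Suppose u : ℝ → ℝⁿ is a C² solution of the second-order system u''(x) = Hess W(u(x)) · ∇W(u(x)) for all x ∈ ℝ, satisfying u(x) → u¹ as x → −∞, and having finite energy, i.e. x ↦ ½|u'(x)|² + ½|∇W(u(x))|² is integrable over ℝ. Then u satisfies the first-order BPS equation u'(x) = −∇W(u(x)) for all x ∈ ℝ. -/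
open MeasureTheory Filter
open scoped RealInnerProductSpace

section LinearODE

variable {E : Type*} [NormedAddCommGroup E] [NormedSpace ℝ E]

/-- A solution of a linear ODE with continuous coefficients that vanishes at `a` vanishes
on `[a, ∞)`. -/
lemma eq_zero_of_hasDerivAt_linear {A : ℝ → E →L[ℝ] E} (hA : Continuous A) {f : ℝ → E}
    (hf : ∀ x, HasDerivAt f (A x (f x)) x) {a x : ℝ} (hax : a ≤ x) (ha : f a = 0) :
    f x = 0 := by
  obtain ⟨K, hK⟩ := isCompact_Icc.exists_bound_of_continuousOn (s := Set.Icc a x) hA.continuousOn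
  refine eq_zero_of_abs_deriv_le_mul_abs_self_of_eq_zero_right (K := K) (a := a) (b := x)
    (fun y _ => (hf y).continuousAt.continuousWithinAt)
    (fun y _ => (hf y).hasDerivWithinAt) ha (fun y hy => ?_) x ⟨hax, le_rfl⟩
  exact (A y).le_of_opNorm_le (hK y ⟨hy.1, hy.2.le⟩) _

end LinearODE

section InnerProduct

variable {E : Type*} [NormedAddCommGroup E] [InnerProductSpace ℝ E]

/-- The gradient of a `C²` function is `C¹`. -/
lemma ContDiff.gradient_of_two [CompleteSpace E] {W : E → ℝ} (hW : ContDiff ℝ 2 W) :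
    ContDiff ℝ 1 (gradient W) :=
  (InnerProductSpace.toDual ℝ E).symm.toContinuousLinearEquiv.contDiff.comp
    (hW.fderiv_right (m := 1) (by norm_num))

/-- Negative definiteness is stable: a continuous family of operators on a finite-dimensional
space which is negative definite at a point is negative semidefinite near that point. -/
lemma eventually_inner_nonpos_of_neg [FiniteDimensional ℝ E] {X : Type*} [TopologicalSpace X]
    {A : X → E →L[ℝ] E} (hA : Continuous A) {p : X}
    (hp : ∀ v : E, v ≠ 0 → ⟪A p v, v⟫ < 0) :
    ∀ᶠ q in nhds p, ∀ v : E, ⟪A q v, v⟫ ≤ 0 := by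
  have h := (isCompact_sphere (0 : E) 1).eventually_forall_of_forall_eventually
    (x₀ := p) (P := fun q v => ⟪A q v, v⟫ < 0) fun v hv => by
      have hc : Continuous fun z : X × E => ⟪A z.1 z.2, z.2⟫ := by fun_prop
      exact hc.continuousAt.eventually_lt_const (hp v (ne_zero_of_mem_unit_sphere ⟨v, hv⟩))
  filter_upwards [h] with q hq v
  by_cases hv : v = 0
  · simp [hv]
  have hn : 0 < ‖v‖ := norm_pos_iff.2 hv
  have h1 := hq (‖v‖⁻¹ • v) (by simp [norm_smul, hn.ne'])
  simp only [map_smul, real_inner_smul_left, real_inner_smul_right] at h1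
  by_contra! h2
  have : 0 < ‖v‖⁻¹ * (‖v‖⁻¹ * ⟪A q v, v⟫) := by positivity
  linarith

/-- If `f' = A f` with `A` negative semidefinite on `(-∞, a]` and `‖f‖²` is integrable, then
`f` vanishes on `(-∞, a]`. -/
lemma eq_zero_of_hasDerivAt_of_inner_nonpos {A : ℝ → E →L[ℝ] E} {f : ℝ → E} {a : ℝ}
    (hf : ∀ x, HasDerivAt f (A x (f x)) x) (hA : ∀ x ≤ a, ∀ v, ⟪A x v, v⟫ ≤ 0)
    (hint : Integrable fun x => ‖f x‖ ^ 2) : f a = 0 := by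
  have hanti : AntitoneOn (fun x => ‖f x‖ ^ 2) (Set.Iic a) := by
    refine antitoneOn_of_deriv_nonpos (convex_Iic a)
      (fun x _ => (hf x).norm_sq.continuousAt.continuousWithinAt)
      (fun x _ => (hf x).norm_sq.differentiableAt.differentiableWithinAt) fun x hx => ?_
    rw [(hf x).norm_sq.deriv, real_inner_comm]
    rw [interior_Iic] at hx
    linarith [hA x (le_of_lt hx) (f x)]
  by_contra h0
  have hconst : IntegrableOn (fun _ : ℝ => ‖f a‖ ^ 2) (Set.Iic a) := by
    refine hint.integrableOn.mono' aestronglyMeasurable_const ?_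
    filter_upwards [ae_restrict_mem measurableSet_Iic] with x hx
    rw [Real.norm_of_nonneg (by positivity)]
    exact hanti hx Set.self_mem_Iic hx
  rw [integrableOn_const_iff] at hconst
  simp [h0] at hconst

end InnerProduct

/-- Negative-definite case of the main theorem. If the Hessian of the
superpotential `W` is negative definite at the critical point `u₁`, then any finite-energy
`C²` solution of the second-order Euler–Lagrange system `u'' = Hess W(u) ⬝ ∇W(u)` with
`u(x) → u₁` as `x → -∞` satisfies the first-order BPS equation `u' = -∇W(u)`. -/
theorem euler_lagrange_implies_bps_negdef (n : ℕ) (hn : 1 ≤ n)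
    (W : EuclideanSpace ℝ (Fin n) → ℝ) (hW : ContDiff ℝ 2 W)
    (u₁ : EuclideanSpace ℝ (Fin n)) (hcrit : gradient W u₁ = 0)
    (hneg : ∀ v : EuclideanSpace ℝ (Fin n), v ≠ 0 →
      ⟪(fderiv ℝ (gradient W) u₁) v, v⟫ < 0)
    (u : ℝ → EuclideanSpace ℝ (Fin n)) (hu : ContDiff ℝ 2 u)
    (hel : ∀ x : ℝ, deriv (deriv u) x = fderiv ℝ (gradient W) (u x) (gradient W (u x)))
    (hbot : Tendsto u atBot (nhds u₁))
    (hint : Integrable (fun x : ℝ =>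
      (1 / 2) * ‖deriv u x‖ ^ 2 + (1 / 2) * ‖gradient W (u x)‖ ^ 2)) :
    ∀ x : ℝ, deriv u x = -gradient W (u x) := by
  have hG := hW.gradient_of_two
  have hH : Continuous (fderiv ℝ (gradient W)) := hG.continuous_fderiv one_ne_zero
  have hu' : ContDiff ℝ 1 (deriv u) := hu.deriv'
  have hf : ∀ x, HasDerivAt (fun y => deriv u y + gradient W (u y))
      (fderiv ℝ (gradient W) (u x) (deriv u x + gradient W (u x))) x := fun x => by
    have h1 := (hu'.differentiable one_ne_zero x).hasDerivAt
    have h2 := (hG.differentiable one_ne_zero (u x)).hasFDerivAt.comp_hasDerivAt x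
      (hu.differentiable two_ne_zero x).hasDerivAt
    rw [map_add, add_comm (fderiv ℝ (gradient W) (u x) (deriv u x)), ← hel x]
    exact h1.add h2
  have hsq : Integrable fun x => ‖deriv u x + gradient W (u x)‖ ^ 2 := by
    have hc : Continuous fun x => ‖deriv u x + gradient W (u x)‖ ^ 2 :=
      ((hu'.continuous.add (hG.continuous.comp hu.continuous)).norm.pow 2)
    refine (hint.const_mul 4).mono' hc.aestronglyMeasurable (ae_of_all _ fun x => ?_)
    rw [Real.norm_of_nonneg (by positivity)]
    nlinarith [parallelogram_law_with_norm ℝ (deriv u x) (gradient W (u x)),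
      sq_nonneg ‖deriv u x - gradient W (u x)‖]
  obtain ⟨a, ha⟩ := eventually_atBot.1
    (hbot.eventually (eventually_inner_nonpos_of_neg hH hneg))
  intro x
  rw [eq_neg_iff_add_eq_zero]
  have hmin : deriv u (min a x) + gradient W (u (min a x)) = 0 :=
    eq_zero_of_hasDerivAt_of_inner_nonpos hf
      (fun y hy => ha y (hy.trans (min_le_left a x))) hsq
  exact eq_zero_of_hasDerivAt_linear (hH.comp hu.continuous) hf (min_le_right a x) hmin
end

section
/- Let n ≥ 1 and let W : ℝⁿ → ℝ be C². Let u¹ ∈ ℝⁿ be a critical point of W at which the Hessian matrix (W_{u_i u_j}(u¹)) is positive definite. Suppose u : ℝ → ℝⁿ is a C² solution of the second-order system u''(x) = Hess W(u(x)) · ∇W(u(x)) for all x ∈ ℝ, satisfying u(x) → u¹ as x → −∞, and having finite energy, i.e. x ↦ ½|u'(x)|² + ½|∇W(u(x))|² is integrable over ℝ. Then u satisfies the first-order BPS equation u'(x) = +∇W(u(x)) for all x ∈ ℝ. -/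
open MeasureTheory Filter
open scoped RealInnerProductSpace

theorem contDiff_gradient {E : Type*} [NormedAddCommGroup E] [InnerProductSpace ℝ E]
    [CompleteSpace E] {W : E → ℝ} (hW : ContDiff ℝ 2 W) : ContDiff ℝ 1 (gradient W) :=
  (InnerProductSpace.toDual ℝ E).symm.contDiff.comp
    (hW.fderiv_right (m := 1) (by norm_num))

/-- A continuous family of operators which is positive definite at a point has nonnegative
quadratic form near that point. -/
theorem eventually_inner_nonneg {X E : Type*} [TopologicalSpace X] [NormedAddCommGroup E]
    [InnerProductSpace ℝ E] [FiniteDimensional ℝ E] {H : X → E →L[ℝ] E} (hH : Continuous H)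
    {p : X} (hpos : ∀ v : E, v ≠ 0 → 0 < ⟪H p v, v⟫) :
    ∀ᶠ q in nhds p, ∀ v : E, 0 ≤ ⟪H q v, v⟫ := by
  have hcont : Continuous fun z : X × E => ⟪H z.1 z.2, z.2⟫ := by fun_prop
  have key : ∀ᶠ q in nhds p, ∀ v ∈ Metric.sphere (0 : E) 1, 0 < ⟪H q v, v⟫ := by
    refine (isCompact_sphere (0 : E) 1).eventually_forall_of_forall_eventually fun v hv => ?_
    exact hcont.continuousAt.eventually_const_lt
      (hpos v (ne_zero_of_mem_unit_sphere ⟨v, hv⟩))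
  filter_upwards [key] with q hq v
  rcases eq_or_ne v 0 with rfl | hv
  · simp
  have h := hq (‖v‖⁻¹ • v) (by simp [norm_smul, hv])
  rw [map_smul, real_inner_smul_left, real_inner_smul_right] at h
  have hinv : 0 < ‖v‖⁻¹ := inv_pos.2 (norm_pos_iff.2 hv)
  exact (pos_of_mul_pos_right (pos_of_mul_pos_right h hinv.le) hinv.le).le

/-- A nonnegative function which is antitone and integrable on a left half-line vanishes there. -/
theorem eq_zero_of_antitoneOn_of_integrable {f : ℝ → ℝ} (hf : ∀ x, 0 ≤ f x) {a : ℝ}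
    (hanti : AntitoneOn f (Set.Iic a)) (hint : Integrable f) {x : ℝ} (hx : x ≤ a) :
    f x = 0 := by
  have hconst : IntegrableOn (fun _ : ℝ => f x) (Set.Iic x) := by
    refine hint.integrableOn.mono' aestronglyMeasurable_const ?_
    filter_upwards [ae_restrict_mem measurableSet_Iic] with y hy
    rw [Real.norm_of_nonneg (hf x)]
    exact hanti (le_trans hy hx) hx hy
  simpa [integrableOn_const_iff] using hconst

/-- Forward uniqueness for a homogeneous linear differential equation. -/
theorem eq_zero_of_linear_ode {E : Type*} [NormedAddCommGroup E] [NormedSpace ℝ E]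
    {A : ℝ → E →L[ℝ] E} (hA : Continuous A) {v : ℝ → E}
    (hv : ∀ x, HasDerivAt v (A x (v x)) x) {a b : ℝ} (hab : a ≤ b) (ha : v a = 0) :
    v b = 0 := by
  obtain ⟨K, hK⟩ := isCompact_Icc.exists_bound_of_continuousOn
    (hA.continuousOn (s := Set.Icc a b))
  have h := norm_le_gronwallBound_of_norm_deriv_right_le (δ := 0) (K := K) (ε := 0)
    (fun x _ => (hv x).continuousAt.continuousWithinAt)
    (fun x _ => (hv x).hasDerivWithinAt) (by simp [ha])
    (fun x hx => by
      rw [add_zero]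
      exact (A x).le_of_opNorm_le (hK x (Set.Ico_subset_Icc_self hx)) _)
    b (Set.right_mem_Icc.2 hab)
  simpa [gronwallBound_ε0] using h


/-- Positive-definite case of the main theorem. If the Hessian of the
superpotential `W` is positive definite at the critical point `u₁`, then any finite-energy
`C²` solution of the second-order Euler–Lagrange system `u'' = Hess W(u) ⬝ ∇W(u)` with
`u(x) → u₁` as `x → -∞` satisfies the first-order BPS equation `u' = +∇W(u)`. -/
theorem euler_lagrange_implies_bps_posdef (n : ℕ) (hn : 1 ≤ n)
    (W : EuclideanSpace ℝ (Fin n) → ℝ) (hW : ContDiff ℝ 2 W)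
    (u₁ : EuclideanSpace ℝ (Fin n)) (hcrit : gradient W u₁ = 0)
    (hpos : ∀ v : EuclideanSpace ℝ (Fin n), v ≠ 0 →
      0 < ⟪(fderiv ℝ (gradient W) u₁) v, v⟫)
    (u : ℝ → EuclideanSpace ℝ (Fin n)) (hu : ContDiff ℝ 2 u)
    (hel : ∀ x : ℝ, deriv (deriv u) x = fderiv ℝ (gradient W) (u x) (gradient W (u x)))
    (hbot : Tendsto u atBot (nhds u₁))
    (hint : Integrable (fun x : ℝ =>
      (1 / 2) * ‖deriv u x‖ ^ 2 + (1 / 2) * ‖gradient W (u x)‖ ^ 2)) :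
    ∀ x : ℝ, deriv u x = gradient W (u x) := by
  have hg := contDiff_gradient hW
  have hH : Continuous (fderiv ℝ (gradient W)) := hg.continuous_fderiv (by norm_num)
  have hdu : ContDiff ℝ 1 (deriv u) := hu.iterate_deriv' 1 1
  set v : ℝ → EuclideanSpace ℝ (Fin n) := fun x => deriv u x - gradient W (u x) with hv_def
  have hv : ∀ x, HasDerivAt v ((-fderiv ℝ (gradient W) (u x)) (v x)) x := by
    intro x
    have h1 := (hdu.differentiable (by norm_num) x).hasDerivAt
    have h2 := (hg.differentiable (by norm_num) (u x)).hasFDerivAt.comp_hasDerivAt x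
      (hu.differentiable (by norm_num) x).hasDerivAt
    refine (h1.sub h2).congr_deriv ?_
    rw [hel x]
    simp [hv_def]
  have hvc : Continuous v := hdu.continuous.sub (hg.continuous.comp hu.continuous)
  have hv_int : Integrable fun x => ‖v x‖ ^ 2 := by
    refine (hint.const_mul 4).mono' (hvc.norm.pow 2).aestronglyMeasurable
      (ae_of_all _ fun x => ?_)
    rw [Real.norm_of_nonneg (by positivity)]
    have := parallelogram_law_with_norm ℝ (deriv u x) (gradient W (u x))
    nlinarith [sq_nonneg ‖deriv u x + gradient W (u x)‖]
  obtain ⟨a, ha⟩ := eventually_atBot.1 (hbot.eventually (eventually_inner_nonneg hH hpos))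
  have hanti : AntitoneOn (fun x => ‖v x‖ ^ 2) (Set.Iic a) := by
    refine antitoneOn_of_hasDerivWithinAt_nonpos (convex_Iic a) (hvc.norm.pow 2).continuousOn
      (fun x _ => (hv x).norm_sq.hasDerivWithinAt) fun x hx => ?_
    have := ha x (interior_subset (s := Set.Iic a) hx) (v x)
    rw [real_inner_comm] at this
    simpa using this
  intro x
  have hzero : v (min a x) = 0 := by
    simpa using eq_zero_of_antitoneOn_of_integrable (fun y => sq_nonneg ‖v y‖) hanti hv_int
      (min_le_left a x)
  exact sub_eq_zero.1
    (eq_zero_of_linear_ode (hH.comp hu.continuous).neg hv (min_le_right a x) hzero)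
end

section
/- Let 0 < r < 1/2 and x₀ ∈ ℝ. The functions φ(x) = tanh(2r(x − x₀)) and χ(x) = √(1/r − 2) · sech(2r(x − x₀)) satisfy the BPS system φ'(x) = 1 − φ(x)² − r χ(x)², χ'(x) = −2r φ(x) χ(x) for all x ∈ ℝ, together with the boundary conditions (φ, χ)(x) → (−1, 0) as x → −∞ and (φ, χ)(x) → (1, 0) as x → +∞. -/
open Filter

theorem Real.hasDerivAt_tanh_inv_sq_cosh (x : ℝ) :
    HasDerivAt Real.tanh ((Real.cosh x ^ 2)⁻¹) x := by
  have h := (Real.hasDerivAt_sinh x).div (Real.hasDerivAt_cosh x) (Real.cosh_pos x).ne'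
  have e : Real.tanh = fun y => Real.sinh y / Real.cosh y :=
    funext Real.tanh_eq_sinh_div_cosh
  rw [e]
  refine h.congr_deriv ?_
  rw [← one_div]
  congr 1
  linarith [Real.cosh_sq x]

theorem Real.tendsto_cosh_atTop_atTop : Tendsto Real.cosh atTop atTop := by
  refine tendsto_atTop_mono (fun x => ?_)
    (Real.tendsto_exp_atTop.atTop_div_const (by norm_num : (0 : ℝ) < 2))
  rw [Real.cosh_eq]
  linarith [Real.exp_pos (-x)]

theorem Real.tendsto_cosh_atBot_atTop : Tendsto Real.cosh atBot atTop :=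
  (Real.tendsto_cosh_atTop_atTop.comp tendsto_neg_atBot_atTop).congr Real.cosh_neg

theorem Real.tendsto_tanh_atTop_one : Tendsto Real.tanh atTop (nhds 1) := by
  have h : Tendsto (fun x : ℝ => 1 - Real.exp (-x) * (Real.cosh x)⁻¹) atTop (nhds (1 - 0 * 0)) :=
    tendsto_const_nhds.sub ((Real.tendsto_exp_atBot.comp tendsto_neg_atTop_atBot).mul
      Real.tendsto_cosh_atTop_atTop.inv_tendsto_atTop)
  rw [mul_zero, sub_zero] at h
  refine h.congr fun x => ?_
  have hc := (Real.cosh_pos x).ne'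
  rw [Real.tanh_eq_sinh_div_cosh, ← Real.cosh_sub_sinh]
  field_simp
  ring

theorem Real.tendsto_tanh_atBot_neg_one : Tendsto Real.tanh atBot (nhds (-1)) :=
  (Real.tendsto_tanh_atTop_one.comp tendsto_neg_atBot_atTop).neg.congr fun x => by
    simp [Real.tanh_neg]

/-- For `0 < r < 1/2`, the explicit pair
`φ(x) = tanh(2r(x - x₀))`, `χ(x) = √(1/r - 2)·sech(2r(x - x₀))` solves the BPS system
`φ' = 1 - φ² - rχ²`, `χ' = -2rφχ` and links `(-1,0)` at `-∞` to `(1,0)` at `+∞`. -/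
theorem two_field_bps_solution (r : ℝ) (hr0 : 0 < r) (hr : r < 1 / 2) (x₀ : ℝ) :
    let φ : ℝ → ℝ := fun x => Real.tanh (2 * r * (x - x₀))
    let χ : ℝ → ℝ := fun x => Real.sqrt (1 / r - 2) * (Real.cosh (2 * r * (x - x₀)))⁻¹
    (∀ x : ℝ, deriv φ x = 1 - (φ x) ^ 2 - r * (χ x) ^ 2) ∧
    (∀ x : ℝ, deriv χ x = -(2 * r * φ x * χ x)) ∧
    Tendsto φ atBot (nhds (-1)) ∧ Tendsto χ atBot (nhds 0) ∧
    Tendsto φ atTop (nhds 1) ∧ Tendsto χ atTop (nhds 0) := by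
  intro φ χ
  have hr2 : 0 < 2 * r := by linarith
  have hlin (x : ℝ) : HasDerivAt (fun y => 2 * r * (y - x₀)) (2 * r) x := by
    simpa using ((hasDerivAt_id x).sub_const x₀).const_mul (2 * r)
  have htop : Tendsto (fun x => 2 * r * (x - x₀)) atTop atTop :=
    (tendsto_atTop_add_const_right _ (-x₀) tendsto_id).const_mul_atTop hr2
  have hbot : Tendsto (fun x => 2 * r * (x - x₀)) atBot atBot :=
    (tendsto_atBot_add_const_right _ (-x₀) tendsto_id).const_mul_atBot hr2
  have hsqrt : Real.sqrt (1 / r - 2) ^ 2 = 1 / r - 2 :=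
    Real.sq_sqrt (by rw [sub_nonneg, le_div_iff₀ hr0]; linarith)
  refine ⟨fun x => ?_, fun x => ?_, Real.tendsto_tanh_atBot_neg_one.comp hbot, ?_,
    Real.tendsto_tanh_atTop_one.comp htop, ?_⟩
  · have h := (Real.hasDerivAt_tanh_inv_sq_cosh (2 * r * (x - x₀))).comp x (hlin x)
    refine h.deriv.trans ?_
    have hc := (Real.cosh_pos (2 * r * (x - x₀))).ne'
    simp only [φ, χ]
    rw [mul_pow, hsqrt, Real.tanh_eq_sinh_div_cosh, div_pow, Real.sinh_sq]
    field_simp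
    ring
  · have hc := (Real.cosh_pos (2 * r * (x - x₀))).ne'
    have h := ((hlin x).cosh.inv hc).const_mul
      (Real.sqrt (1 / r - 2))
    refine h.deriv.trans ?_
    simp only [φ, χ]
    rw [Real.tanh_eq_sinh_div_cosh]
    field_simp
  · simpa [χ] using ((Real.tendsto_cosh_atBot_atTop.comp hbot).inv_tendsto_atTop).const_mul
      (Real.sqrt (1 / r - 2))
  · simpa [χ] using ((Real.tendsto_cosh_atTop_atTop.comp htop).inv_tendsto_atTop).const_mul
      (Real.sqrt (1 / r - 2))
end

section
/- Let r > 0. There is no C¹ solution (φ, χ) : ℝ → ℝ² of the BPS system (φ', χ') = ±(φ² + rχ² − 1, 2rφχ) (with either fixed choice of sign) satisfying χ(x) → −1/√r as x → −∞ and χ(x) → 1/√r as x → +∞. (Any such χ would vanish at some x₀, and by uniqueness for the linear ODE χ' = ±2rφ(x)χ this forces χ ≡ 0, a contradiction.) -/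
open Filter

/-- A solution of the scalar linear equation `f' = a f` with continuous coefficient `a` that
vanishes at one point vanishes identically. -/
theorem eq_zero_of_hasDerivAt_mul_self {a f : ℝ → ℝ} (ha : Continuous a)
    (hf : ∀ x, HasDerivAt f (a x * f x) x) {x₀ : ℝ} (h₀ : f x₀ = 0) (x : ℝ) : f x = 0 := by
  have hE (y : ℝ) : HasDerivAt (fun z => f z * Real.exp (-∫ t in x₀..z, a t)) 0 y := by
    have hI := intervalIntegral.integral_hasDerivAt_right (ha.intervalIntegrable x₀ y)
      ha.aestronglyMeasurable.stronglyMeasurableAtFilter ha.continuousAt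
    exact ((hf y).mul hI.neg.exp).congr_deriv (by simp only [Pi.neg_apply]; ring)
  have hc := is_const_of_deriv_eq_zero (fun y => (hE y).differentiableAt)
    (fun y => (hE y).deriv) x x₀
  simpa [h₀, Real.exp_ne_zero] using hc

/-- For `r > 0`, the BPS system `(φ', χ') = ±(φ² + rχ² − 1, 2rφχ)`
(for either fixed choice of sign, encoded by `ε ∈ {1, -1}`) admits no `C¹` solution with
`χ(-∞) = -1/√r` and `χ(+∞) = 1/√r`. -/
theorem two_field_no_bps_wall_u3_u4 (r : ℝ) (hr : 0 < r)
    (ε : ℝ) (hε : ε = 1 ∨ ε = -1) :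
    ¬ ∃ φ χ : ℝ → ℝ, ContDiff ℝ 1 φ ∧ ContDiff ℝ 1 χ ∧
      (∀ x : ℝ, deriv φ x = ε * ((φ x) ^ 2 + r * (χ x) ^ 2 - 1)) ∧
      (∀ x : ℝ, deriv χ x = ε * (2 * r * φ x * χ x)) ∧
      Tendsto χ atBot (nhds (-(1 / Real.sqrt r))) ∧
      Tendsto χ atTop (nhds (1 / Real.sqrt r)) := by
  rintro ⟨φ, χ, hφ, hχ, -, hχ', hbot, htop⟩
  have hpos : 0 < 1 / Real.sqrt r := by positivity
  obtain ⟨b, hb⟩ := (hbot.eventually_lt_const (neg_lt_zero.2 hpos)).exists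
  obtain ⟨c, hc⟩ := (htop.eventually_const_lt hpos).exists
  obtain ⟨x₀, h₀⟩ := mem_range_of_exists_le_of_exists_ge hχ.continuous ⟨b, hb.le⟩ ⟨c, hc.le⟩
  have hzero : χ c = 0 := by
    refine eq_zero_of_hasDerivAt_mul_self (a := fun x => ε * (2 * r * φ x))
      (continuous_const.mul (continuous_const.mul hφ.continuous)) (fun x => ?_) h₀ c
    have h := (hχ.differentiable one_ne_zero x).hasDerivAt
    rwa [hχ', ← mul_assoc] at h
  exact hc.ne' hzero
end

section
/- Let r > 0 and let χ : ℝ → ℝ be a C² solution of χ'' = 2r(rχ² − 1)χ with χ(x) → −1/√r as x → −∞ and χ(x) → 1/√r as x → +∞, such that x ↦ ½χ'(x)² + ½(rχ(x)² − 1)² is integrable over ℝ. Then χ satisfies the first-order equation χ'(x) = 1 − rχ(x)² for all x ∈ ℝ. -/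
open MeasureTheory Filter

/-- A solution of the scalar linear equation `u' = a u` is `u 0` times a positive function. -/
theorem exists_pos_factor_of_linear_ode {a u : ℝ → ℝ} (ha : Continuous a)
    (hu : ∀ x, HasDerivAt u (a x * u x) x) :
    ∃ g : ℝ → ℝ, (∀ x, 0 < g x) ∧ ∀ x, u x = u 0 * g x := by
  set A : ℝ → ℝ := fun x => ∫ t in (0 : ℝ)..x, a t with hA
  have hAd : ∀ x, HasDerivAt A (a x) x := fun x =>
    intervalIntegral.integral_hasDerivAt_right (ha.intervalIntegrable 0 x)
      (ha.stronglyMeasurableAtFilter _ _) ha.continuousAt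
  have hd : ∀ x, HasDerivAt (fun y => u y * Real.exp (-A y)) 0 x := fun x => by
    refine ((hu x).mul (hAd x).neg.exp).congr_deriv ?_
    simp only [Pi.neg_apply]
    ring
  have hconst : ∀ x, u x * Real.exp (-A x) = u 0 := fun x => by
    have h := is_const_of_deriv_eq_zero (fun y => (hd y).differentiableAt)
      (fun y => (hd y).deriv) x 0
    simpa [hA] using h
  refine ⟨fun x => Real.exp (A x), fun x => Real.exp_pos _, fun x => ?_⟩
  rw [← hconst x, mul_assoc, ← Real.exp_add, neg_add_cancel, Real.exp_zero, mul_one]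

/-- For the single-field reduction, any finite-energy `C²` solution of
`χ'' = 2r(rχ² − 1)χ` linking `-1/√r` (at `-∞`) to `1/√r` (at `+∞`) satisfies the
first-order BPS equation `χ' = 1 − rχ²`. -/
theorem single_field_el_implies_bps (r : ℝ) (hr : 0 < r)
    (χ : ℝ → ℝ) (hχ : ContDiff ℝ 2 χ)
    (hel : ∀ x : ℝ, deriv (deriv χ) x = 2 * r * (r * (χ x) ^ 2 - 1) * χ x)
    (hbot : Tendsto χ atBot (nhds (-(1 / Real.sqrt r))))
    (htop : Tendsto χ atTop (nhds (1 / Real.sqrt r)))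
    (hint : Integrable (fun x : ℝ =>
      (1 / 2) * (deriv χ x) ^ 2 + (1 / 2) * (r * (χ x) ^ 2 - 1) ^ 2)) :
    ∀ x : ℝ, deriv χ x = 1 - r * (χ x) ^ 2 := by
  have hpos : 0 < 1 / Real.sqrt r := by positivity
  have hdiff : Differentiable ℝ χ := hχ.differentiable (by norm_num)
  have hd : ∀ x, HasDerivAt χ (deriv χ x) x := fun x => (hdiff x).hasDerivAt
  have hdiff' : Differentiable ℝ (deriv χ) := by
    have h : ContDiff ℝ (1 + 1) χ := by norm_num; exact hχ
    exact (contDiff_succ_iff_deriv.1 h).2.2.differentiable (by norm_num)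
  have hd2 : ∀ x, HasDerivAt (deriv χ) (2 * r * (r * (χ x) ^ 2 - 1) * χ x) x := fun x =>
    hel x ▸ (hdiff' x).hasDerivAt
  have hw : ∀ x, HasDerivAt (fun y => 1 - r * χ y ^ 2) (-(2 * r * χ x * deriv χ x)) x :=
    fun x => by
      refine ((((hd x).pow 2).const_mul r).const_sub 1).congr_deriv ?_
      push_cast
      ring
  obtain ⟨g, hg, hu⟩ := exists_pos_factor_of_linear_ode
    (a := fun x => 2 * r * χ x) (u := fun x => deriv χ x - (1 - r * χ x ^ 2))
    (hdiff.continuous.const_mul (2 * r))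
    (fun x => by
      refine ((hd2 x).sub (hw x)).congr_deriv ?_
      ring)
  -- The first integral `χ'² - (1 - rχ²)²` is constant, hence zero by integrability.
  have hE : ∀ x, HasDerivAt (fun y => deriv χ y ^ 2 - (1 - r * χ y ^ 2) ^ 2) 0 x := fun x => by
    refine (((hd2 x).pow 2).sub ((hw x).pow 2)).congr_deriv ?_
    push_cast
    ring
  obtain ⟨c, hc⟩ : ∃ c, ∀ x, deriv χ x ^ 2 - (1 - r * χ x ^ 2) ^ 2 = c :=
    ⟨_, fun x => is_const_of_deriv_eq_zero (fun y => (hE y).differentiableAt)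
      (fun y => (hE y).deriv) x 0⟩
  have hc0 : c = 0 := by
    have hci : Integrable (fun _ : ℝ => c) := by
      refine (hint.const_mul 2).mono' aestronglyMeasurable_const (ae_of_all _ fun x => ?_)
      rw [Real.norm_eq_abs, ← hc x, abs_le]
      constructor <;> nlinarith [sq_nonneg (deriv χ x), sq_nonneg (r * χ x ^ 2 - 1)]
    rcases integrable_const_iff.1 hci with h | h
    · exact h
    · have := h.measure_univ_lt_top
      simp at this
  subst hc0
  obtain ⟨z, hz⟩ : ∃ z, χ z = 0 := mem_range_of_exists_le_of_exists_ge hdiff.continuous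
    (((hbot.eventually_lt_const (neg_lt_zero.2 hpos)).exists).imp fun _ h => h.le)
    (((htop.eventually_const_lt hpos).exists).imp fun _ h => h.le)
  rcases eq_or_ne (deriv χ 0 - (1 - r * χ 0 ^ 2)) 0 with h0 | h0
  · intro x
    have := hu x
    simp only [h0, zero_mul] at this
    linarith
  exfalso
  have hv : ∀ x, deriv χ x = -(1 - r * χ x ^ 2) := fun x => by
    have hne : deriv χ x - (1 - r * χ x ^ 2) ≠ 0 := by
      rw [show _ = _ from hu x]
      exact mul_ne_zero h0 (hg x).ne'
    have := mul_left_cancel₀ hne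
      (show _ * (deriv χ x + (1 - r * χ x ^ 2)) = _ * 0 by linear_combination hc x)
    linarith
  have huz := hu z
  simp only [hv z, hz] at huz
  have hneg : deriv χ 0 - (1 - r * χ 0 ^ 2) < 0 := by
    by_contra! h
    nlinarith [mul_nonneg h (hg z).le]
  have hanti : Antitone χ := antitone_of_deriv_nonpos hdiff fun x => by
    have h1 := mul_neg_of_neg_of_pos hneg (hg x)
    have h2 := hu x
    have h3 := hv x
    linarith
  linarith [hanti.le_of_tendsto htop 0, hanti.ge_of_tendsto hbot 0]
end

section
/- Let m, η, λ > 0 and x₀ ∈ ℝ. The triple Z ≡ −m/λ, Σ ≡ 0, Φ(x) = η tanh((λη/2)(x − x₀)) is a C² solution on ℝ of the Euler–Lagrange system Z'' = λ²(Σ²Z + Φ²(Z + m/λ)), Σ'' = (λ²/2)(Σ² + Φ² − η²)Σ + λ²Z²Σ, Φ'' = (λ²/2)(Σ² + Φ² − η²)Φ + λ²(Z + m/λ)²Φ, satisfying (Z, Σ, Φ)(±∞) = (−m/λ, 0, ±η); i.e., it is a finite-energy domain wall linking the ground states u³ = (−m/λ, 0, −η) and u⁴ = (−m/λ, 0, η).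 -/
open Filter

namespace Real

theorem hasDerivAt_tanh (x : ℝ) : HasDerivAt tanh (1 - tanh x ^ 2) x := by
  have hc : cosh x ≠ 0 := (cosh_pos x).ne'
  have h := (hasDerivAt_sinh x).div (hasDerivAt_cosh x) hc
  rw [show sinh / cosh = tanh from funext fun y => (tanh_eq_sinh_div_cosh y).symm] at h
  refine h.congr_deriv ?_
  rw [tanh_eq_sinh_div_cosh]
  field_simp

theorem contDiff_tanh {n : WithTop ℕ∞} : ContDiff ℝ n tanh := by
  rw [show tanh = fun y => sinh y / cosh y from funext tanh_eq_sinh_div_cosh]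
  exact contDiff_sinh.div contDiff_cosh fun y => (cosh_pos y).ne'

theorem tendsto_tanh_atTop : Tendsto tanh atTop (nhds 1) := by
  have h : tanh = fun y => 1 - 2 / (exp (2 * y) + 1) := by
    funext y
    have hy : exp (2 * y) = exp y ^ 2 := by rw [← exp_nat_mul]; norm_num
    rw [tanh_eq, hy, exp_neg]
    field_simp
    ring
  rw [h]
  have h₁ : Tendsto (fun y : ℝ => exp (2 * y) + 1) atTop atTop :=
    tendsto_atTop_add_const_right _ _
      (tendsto_exp_atTop.comp (tendsto_id.const_mul_atTop two_pos))
  simpa using (h₁.const_div_atTop 2).const_sub 1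

theorem tendsto_tanh_atBot : Tendsto tanh atBot (nhds (-1)) := by
  have h := (tendsto_tanh_atTop.comp tendsto_neg_atBot_atTop).neg
  simpa [Function.comp_def] using h

end Real

/-- For `m, η, λ > 0`, the triple `Z ≡ -m/λ`, `Σ ≡ 0`,
`Φ(x) = η·tanh((λη/2)(x - x₀))` is a `C²` solution of the Euler–Lagrange system of the
Burinskii–Morris model, linking the ground states `(-m/λ, 0, -η)` and `(-m/λ, 0, η)`. -/
theorem burinskii_morris_non_bps_wall (m η lam : ℝ)
    (hm : 0 < m) (hη : 0 < η) (hlam : 0 < lam) (x₀ : ℝ) :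
    let Z : ℝ → ℝ := fun _ => -(m / lam)
    let S : ℝ → ℝ := fun _ => 0
    let Φ : ℝ → ℝ := fun x => η * Real.tanh (lam * η / 2 * (x - x₀))
    ContDiff ℝ 2 Z ∧ ContDiff ℝ 2 S ∧ ContDiff ℝ 2 Φ ∧
    (∀ x : ℝ, deriv (deriv Z) x =
      lam ^ 2 * ((S x) ^ 2 * Z x + (Φ x) ^ 2 * (Z x + m / lam))) ∧
    (∀ x : ℝ, deriv (deriv S) x =
      lam ^ 2 / 2 * ((S x) ^ 2 + (Φ x) ^ 2 - η ^ 2) * S x + lam ^ 2 * (Z x) ^ 2 * S x) ∧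
    (∀ x : ℝ, deriv (deriv Φ) x =
      lam ^ 2 / 2 * ((S x) ^ 2 + (Φ x) ^ 2 - η ^ 2) * Φ x
        + lam ^ 2 * (Z x + m / lam) ^ 2 * Φ x) ∧
    Tendsto Z atBot (nhds (-(m / lam))) ∧ Tendsto S atBot (nhds 0) ∧
    Tendsto Φ atBot (nhds (-η)) ∧
    Tendsto Z atTop (nhds (-(m / lam))) ∧ Tendsto S atTop (nhds 0) ∧
    Tendsto Φ atTop (nhds η) := by
  intro Z S Φ
  have hk : 0 < lam * η / 2 := by positivity
  have hΦ : ∀ x, HasDerivAt Φ (lam / 2 * (η ^ 2 - Φ x ^ 2)) x := by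
    intro x
    have hlin : HasDerivAt (fun y => lam * η / 2 * (y - x₀)) (lam * η / 2) x := by
      simpa using ((hasDerivAt_id x).sub_const x₀).const_mul (lam * η / 2)
    refine (((Real.hasDerivAt_tanh _).comp x hlin).const_mul η).congr_deriv ?_
    simp only [Φ]
    ring
  have hΦ' : deriv Φ = fun x => lam / 2 * (η ^ 2 - Φ x ^ 2) := funext fun x => (hΦ x).deriv
  have hTop : Tendsto (fun x => lam * η / 2 * (x - x₀)) atTop atTop :=
    (tendsto_atTop_add_const_right _ (-x₀) tendsto_id).const_mul_atTop hk
  have hBot : Tendsto (fun x => lam * η / 2 * (x - x₀)) atBot atBot :=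
    (tendsto_atBot_add_const_right _ (-x₀) tendsto_id).const_mul_atBot hk
  refine ⟨contDiff_const, contDiff_const, ?_, ?_, ?_, ?_, tendsto_const_nhds,
    tendsto_const_nhds, ?_, tendsto_const_nhds, tendsto_const_nhds, ?_⟩
  · exact contDiff_const.mul (Real.contDiff_tanh.comp
      (contDiff_const.mul (contDiff_id.sub contDiff_const)))
  · intro x
    simp [Z, S]
  · intro x
    simp [S]
  · intro x
    rw [hΦ']
    refine ((((hΦ x).pow 2).const_sub (η ^ 2)).const_mul (lam / 2)).deriv.trans ?_
    simp only [S, Z]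
    push_cast
    ring
  · simpa using (Real.tendsto_tanh_atBot.comp hBot).const_mul η
  · simpa using (Real.tendsto_tanh_atTop.comp hTop).const_mul η
end

section
/- Let m, η, λ > 0. There is no C¹ solution (Z, Σ, Φ) : ℝ → ℝ³ of the BPS system (Z', Σ', Φ') = ∓((λ/2)(Σ² + Φ² − η²), λZΣ, (λZ + m)Φ) (with either fixed choice of sign) satisfying Φ(x) → −η as x → −∞ and Φ(x) → η as x → +∞. (Any such Φ would vanish at some x₀, and by uniqueness for the linear ODE Φ' = ∓(λZ(x) + m)Φ this forces Φ ≡ 0, a contradiction.) In particular, the Euler–Lagrange system of the model admits domain walls linking u³ = (−m/λ, 0, −η) and u⁴ = (−m/λ, 0, η) which are not BPS. -/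
open Filter

/-- A solution of a scalar homogeneous linear ODE `f' = g f` with continuous coefficient is a
constant multiple of the exponential of the antiderivative of `g`. -/
lemma eq_mul_exp_integral_of_deriv_eq_mul {f g : ℝ → ℝ} (hg : Continuous g)
    (hf : Differentiable ℝ f) (h : ∀ x, deriv f x = g x * f x) (x : ℝ) :
    f x = f 0 * Real.exp (∫ t in (0 : ℝ)..x, g t) := by
  set G : ℝ → ℝ := fun x => ∫ t in (0 : ℝ)..x, g t
  have hG' (y : ℝ) : HasDerivAt G (g y) y := hg.integral_hasStrictDerivAt 0 y |>.hasDerivAt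
  have hd (y : ℝ) : HasDerivAt (fun z => f z * Real.exp (-G z)) 0 y := by
    refine ((hf y).hasDerivAt.mul (hG' y).fun_neg.exp).congr_deriv ?_
    rw [h y]
    ring
  have hconst : f x * Real.exp (-G x) = f 0 * Real.exp (-G 0) :=
    is_const_of_deriv_eq_zero (fun y => (hd y).differentiableAt) (fun y => (hd y).deriv) x 0
  have hG0 : G 0 = 0 := intervalIntegral.integral_same
  rw [hG0, neg_zero, Real.exp_zero, mul_one] at hconst
  change f x = f 0 * Real.exp (G x)
  rw [← hconst, mul_assoc, ← Real.exp_add, neg_add_cancel, Real.exp_zero, mul_one]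

/-- The Burinskii–Morris BPS system
`(Z', Σ', Φ') = ∓((λ/2)(Σ² + Φ² − η²), λZΣ, (λZ + m)Φ)` (for either fixed choice of sign,
encoded by `ε ∈ {1, -1}`) admits no `C¹` solution with `Φ(-∞) = -η` and `Φ(+∞) = η`. -/
theorem burinskii_morris_no_bps_wall (m η lam : ℝ)
    (hm : 0 < m) (hη : 0 < η) (hlam : 0 < lam)
    (ε : ℝ) (hε : ε = 1 ∨ ε = -1) :
    ¬ ∃ Z S Φ : ℝ → ℝ, ContDiff ℝ 1 Z ∧ ContDiff ℝ 1 S ∧ ContDiff ℝ 1 Φ ∧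
      (∀ x : ℝ, deriv Z x = ε * (lam / 2 * ((S x) ^ 2 + (Φ x) ^ 2 - η ^ 2))) ∧
      (∀ x : ℝ, deriv S x = ε * (lam * Z x * S x)) ∧
      (∀ x : ℝ, deriv Φ x = ε * ((lam * Z x + m) * Φ x)) ∧
      Tendsto Φ atBot (nhds (-η)) ∧ Tendsto Φ atTop (nhds η) := by
  rintro ⟨Z, S, Φ, hZ, -, hΦ, -, -, hode, hbot, htop⟩
  have hZc : Continuous Z := hZ.continuous
  have hsol := eq_mul_exp_integral_of_deriv_eq_mul (f := Φ) (g := fun x => ε * (lam * Z x + m))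
    (by fun_prop) (hΦ.differentiable one_ne_zero) (fun x => by rw [hode x, mul_assoc])
  rcases le_total 0 (Φ 0) with h0 | h0
  · have : 0 ≤ -η := ge_of_tendsto' hbot fun x => by
      rw [hsol x]; exact mul_nonneg h0 (Real.exp_pos _).le
    linarith
  · have : η ≤ 0 := le_of_tendsto' htop fun x => by
      rw [hsol x]; exact mul_nonpos_of_nonpos_of_nonneg h0 (Real.exp_pos _).le
    linarith
end

section
/- Let Λ > 0, m > 0, and 0 < X ≤ ∞. If u : [0, X) → ℝ is a C² solution of u'' = Λ(e^u − 1) + Λe^{−2mx + u} such that u'(x) ≥ 0 for all x ∈ [0, X), then u'(x) > 0 for all x ∈ (0, X). -/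
open Filter

/-- Lemma 1: Let `0 < X ≤ ∞` (an extended real). If `u` is a `C²` solution
of `u'' = Λ(eᵘ − 1) + Λe^{−2mx+u}` on `[0, X)` with `u' ≥ 0` on `[0, X)`, then `u' > 0`
on `(0, X)`. -/
theorem deriv_pos_of_deriv_nonneg (Λ m : ℝ) (hΛ : 0 < Λ) (hm : 0 < m)
    (X : EReal) (hX : 0 < X)
    (u : ℝ → ℝ) (hu : ContDiff ℝ 2 u)
    (heq : ∀ x : ℝ, 0 ≤ x → (x : EReal) < X → deriv (deriv u) x =
      Λ * (Real.exp (u x) - 1) + Λ * Real.exp (-(2 * m * x) + u x))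
    (hnonneg : ∀ x : ℝ, 0 ≤ x → (x : EReal) < X → 0 ≤ deriv u x) :
    ∀ x : ℝ, 0 < x → (x : EReal) < X → 0 < deriv u x := by
  intro x hx hxX
  refine (hnonneg x hx.le hxX).lt_of_ne' fun h0 => ?_
  have hdom : ∀ᶠ y : ℝ in nhds x, 0 < y ∧ (y : EReal) < X :=
    (eventually_gt_nhds hx).and
      (continuous_coe_real_ereal.continuousAt.eventually (gt_mem_nhds hxX))
  have hmin : IsLocalMin (deriv u) x := by
    filter_upwards [hdom] with y hy
    rw [h0]
    exact hnonneg y hy.1.le hy.2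
  have hode : deriv (deriv u) =ᶠ[nhds x] fun y =>
      Λ * (Real.exp (u y) - 1) + Λ * Real.exp (-(2 * m * y) + u y) := by
    filter_upwards [hdom] with y hy using heq y hy.1.le hy.2
  have hu' : HasDerivAt u 0 x := by
    simpa [h0] using (hu.differentiable (by norm_num) x).hasDerivAt
  have hthird : deriv (deriv (deriv u)) x =
      -(2 * m * Λ * Real.exp (-(2 * m * x) + u x)) := by
    rw [hode.deriv_eq]
    have hlin : HasDerivAt (fun y : ℝ => -(2 * m * y)) (-(2 * m)) x := by
      simpa using (hasDerivAt_id x).const_mul (2 * m) |>.fun_neg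
    refine (((hu'.exp.sub_const 1).const_mul Λ).add
      ((hlin.add hu').exp.const_mul Λ)).deriv.trans ?_
    simp only [Pi.add_apply]
    ring
  have hneg : deriv (deriv (deriv u)) x < 0 := by
    rw [hthird, neg_lt_zero]
    positivity
  have hmax : IsLocalMax (deriv u) x :=
    isLocalMax_of_deriv_deriv_neg hneg hmin.deriv_eq_zero
      (hu.continuous_deriv (by norm_num)).continuousAt
  have hzero : deriv u =ᶠ[nhds x] fun _ => 0 := by
    filter_upwards [hmin, hmax] with y hy₁ hy₂
    exact (hy₂.antisymm hy₁).trans h0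
  have : deriv (deriv (deriv u)) x = 0 := by
    simpa using hzero.deriv.deriv_eq
  exact hneg.ne this
end

section
/- Let Λ > 0, m > 0, a > 0, x₀ > 0, and let b ∈ ℝ satisfy b − Λx₀ > 0 and −a + bx₀ − ½Λx₀² > 0. If u : [0, x₀] → ℝ is a C² solution of u'' = Λ(e^u − 1) + Λe^{−2mx + u} with u(0) = −a and u'(0) = b, then u'(x) > 0 for all x ∈ [0, x₀] and u(x₀) > 0. -/
/-- Comparison of two functions on an interval through their derivatives. -/
theorem le_of_hasDerivAt_le {f g f' g' : ℝ → ℝ} {c d : ℝ}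
    (hf : ∀ x ∈ Set.Icc c d, HasDerivAt f (f' x) x)
    (hg : ∀ x ∈ Set.Icc c d, HasDerivAt g (g' x) x)
    (hle : ∀ x ∈ Set.Icc c d, f' x ≤ g' x) (hc : f c ≤ g c) :
    ∀ x ∈ Set.Icc c d, f x ≤ g x := by
  intro x hx
  exact image_le_of_deriv_right_le_deriv_boundary
    (fun y hy => (hf y hy).continuousAt.continuousWithinAt)
    (fun y hy => (hf y (Set.Ico_subset_Icc_self hy)).hasDerivWithinAt) hc
    (fun y hy => (hg y hy).continuousAt.continuousWithinAt)
    (fun y hy => (hg y (Set.Ico_subset_Icc_self hy)).hasDerivWithinAt)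
    (fun y hy => hle y (Set.Ico_subset_Icc_self hy)) hx

/-- key step in Lemma 2: If `b − Λx₀ > 0` and `−a + bx₀ − ½Λx₀² > 0`, then
the solution of `u'' = Λ(eᵘ − 1) + Λe^{−2mx+u}` on `[0, x₀]` with `u(0) = -a`, `u'(0) = b`
satisfies `u' > 0` on `[0, x₀]` and `u(x₀) > 0`. -/
theorem shooting_large_slope (Λ m a x₀ b : ℝ)
    (hΛ : 0 < Λ) (hm : 0 < m) (ha : 0 < a) (hx₀ : 0 < x₀)
    (hb1 : 0 < b - Λ * x₀) (hb2 : 0 < -a + b * x₀ - (1 / 2) * Λ * x₀ ^ 2)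
    (u : ℝ → ℝ) (hu : ContDiff ℝ 2 u)
    (heq : ∀ x ∈ Set.Icc 0 x₀, deriv (deriv u) x =
      Λ * (Real.exp (u x) - 1) + Λ * Real.exp (-(2 * m * x) + u x))
    (hu0 : u 0 = -a) (hu0' : deriv u 0 = b) :
    (∀ x ∈ Set.Icc 0 x₀, 0 < deriv u x) ∧ 0 < u x₀ := by
  have hlow : ∀ x ∈ Set.Icc 0 x₀, -Λ ≤ deriv (deriv u) x := by
    intro x hx
    rw [heq x hx]
    have h₁ := mul_pos hΛ (Real.exp_pos (u x))
    have h₂ := mul_pos hΛ (Real.exp_pos (-(2 * m * x) + u x))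
    linarith
  have hdu : Differentiable ℝ u := hu.differentiable (by norm_num)
  have hddu : Differentiable ℝ (deriv u) :=
    (contDiff_succ_iff_deriv (n := 1).1 hu).2.2.differentiable (by norm_num)
  have hslope : ∀ x ∈ Set.Icc 0 x₀, b - Λ * x ≤ deriv u x := by
    intro x hx
    have h := le_of_hasDerivAt_le (f := fun y => b - Λ * y) (f' := fun _ => -Λ)
      (fun y _ => by simpa using ((hasDerivAt_id y).const_mul Λ).const_sub b)
      (fun y _ => (hddu y).hasDerivAt) hlow (by simp [hu0']) x hx
    exact h
  refine ⟨fun x hx => ?_, ?_⟩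
  · have h := mul_le_mul_of_nonneg_left hx.2 hΛ.le
    linarith [hslope x hx]
  · have h := le_of_hasDerivAt_le (f := fun y => -a + b * y - (1 / 2) * Λ * y ^ 2)
      (f' := fun y => b - Λ * y)
      (fun y _ => by
        have := (((hasDerivAt_id y).const_mul b).const_add (-a)).sub
          (((hasDerivAt_id y).pow 2).const_mul ((1 / 2) * Λ))
        refine HasDerivAt.congr_deriv this ?_
        simp only [id, Nat.cast_ofNat]
        ring)
      (fun y _ => (hdu y).hasDerivAt) hslope (by simp [hu0]) x₀ ⟨hx₀.le, le_rfl⟩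
    exact hb2.trans_le h
end

section
/- Let Λ > 0 and m > 0. If u : [0, ∞) → ℝ is a C² solution of u'' = Λ(e^u − 1) + Λe^{−2mx + u} with u(x) ≤ 0 for all x ≥ 0, then u(x) < 0 for all x > 0. (If u(x₀) = 0 at some x₀ > 0, then x₀ would be a local maximum of u, yet the equation gives u''(x₀) = Λe^{−2mx₀} > 0, a contradiction.) -/
open Filter Topology in
/-- The second derivative is nonpositive at a local maximum. -/
theorem IsLocalMax.deriv_deriv_nonpos {f : ℝ → ℝ} {a : ℝ} (h : IsLocalMax f a)
    (hc : ContinuousAt f a) : deriv (deriv f) a ≤ 0 := by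
  by_contra! hpos
  have hmin : IsLocalMin f a := isLocalMin_of_deriv_deriv_pos hpos h.deriv_eq_zero hc
  have hconst : f =ᶠ[𝓝 a] fun _ => f a := by
    filter_upwards [h, hmin] with x h₁ h₂ using le_antisymm h₁ h₂
  have hzero : deriv (deriv f) a = 0 := by simpa using hconst.deriv.deriv_eq
  exact hpos.ne' hzero

/-- second part of Lemma 3: If `u` is a `C²` solution of
`u'' = Λ(eᵘ − 1) + Λe^{−2mx+u}` on `[0, ∞)` with `u ≤ 0` on `[0, ∞)`, then in fact
`u < 0` on `(0, ∞)`. -/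
theorem sol_neg_of_nonpos (Λ m : ℝ) (hΛ : 0 < Λ) (hm : 0 < m)
    (u : ℝ → ℝ) (hu : ContDiff ℝ 2 u)
    (heq : ∀ x : ℝ, 0 ≤ x → deriv (deriv u) x =
      Λ * (Real.exp (u x) - 1) + Λ * Real.exp (-(2 * m * x) + u x))
    (hnonpos : ∀ x : ℝ, 0 ≤ x → u x ≤ 0) :
    ∀ x : ℝ, 0 < x → u x < 0 := by
  intro x hx
  refine (hnonpos x hx.le).lt_of_ne fun h0 => ?_
  have hmax : IsLocalMax u x := by
    filter_upwards [Ioi_mem_nhds hx] with y hy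
    exact (hnonpos y (le_of_lt hy)).trans_eq h0.symm
  have hle := hmax.deriv_deriv_nonpos hu.continuous.continuousAt
  rw [heq x hx.le, h0] at hle
  have hpos : 0 < Λ * Real.exp (-(2 * m * x) + 0) := by positivity
  simp only [Real.exp_zero, sub_self, mul_zero, zero_add] at hle
  exact hle.not_gt hpos
end

section
/- Let Λ > 0 and m > 0. If u : [0, ∞) → ℝ is a C² solution of u'' = Λ(e^u − 1) + Λe^{−2mx + u} with u'(x) > 0 and u(x) < 0 for all x ≥ 0, then u(x) → 0 as x → ∞. -/
open Filter

/-- Lemma 4: If `u` is a `C²` solution of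
`u'' = Λ(eᵘ − 1) + Λe^{−2mx+u}` on `[0, ∞)` with `u' > 0` and `u < 0` on `[0, ∞)`, then
`u(x) → 0` as `x → ∞`. -/
theorem sol_tendsto_zero (Λ m : ℝ) (hΛ : 0 < Λ) (hm : 0 < m)
    (u : ℝ → ℝ) (hu : ContDiff ℝ 2 u)
    (heq : ∀ x : ℝ, 0 ≤ x → deriv (deriv u) x =
      Λ * (Real.exp (u x) - 1) + Λ * Real.exp (-(2 * m * x) + u x))
    (hderiv : ∀ x : ℝ, 0 ≤ x → 0 < deriv u x)
    (hneg : ∀ x : ℝ, 0 ≤ x → u x < 0) :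
    Tendsto u atTop (nhds 0) := by
  have hdu : Differentiable ℝ u := hu.differentiable (by norm_num)
  have hddu : Differentiable ℝ (deriv u) :=
    ((contDiff_succ_iff_deriv (n := 1)).1 hu).2.2.differentiable (by norm_num)
  have hmono : StrictMonoOn u (Set.Ici 0) := by
    refine strictMonoOn_of_deriv_pos (convex_Ici 0) hdu.continuous.continuousOn ?_
    intro x hx
    rw [interior_Ici] at hx
    exact hderiv x (le_of_lt hx)
  have key : ∀ ε : ℝ, 0 < ε → ∃ x : ℝ, 0 ≤ x ∧ -ε < u x := by
    intro ε hε
    by_contra! hbound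
    set q := Real.exp (-ε) with hq
    have hq1 : q < 1 := Real.exp_lt_one_iff.2 (by linarith)
    have hq0 : 0 < q := Real.exp_pos _
    have hlim : Tendsto (fun x : ℝ => Real.exp (-(2 * m * x))) atTop (nhds 0) :=
      Real.tendsto_exp_neg_atTop_nhds_zero.comp
        (tendsto_id.const_mul_atTop (by positivity : 0 < 2 * m))
    obtain ⟨X, hX⟩ := eventually_atTop.1 (hlim.eventually_lt_const
      (by linarith : (0 : ℝ) < (1 - q) / 2))
    set Y := max X 0
    have hY0 : 0 ≤ Y := le_max_right _ _
    set c := Λ * ((1 - q) / 2)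
    have hc : 0 < c := mul_pos hΛ (by linarith)
    have hdd : ∀ x, Y ≤ x → deriv (deriv u) x ≤ -c := by
      intro x hx
      have hx0 : 0 ≤ x := hY0.trans hx
      have h1 := hX x ((le_max_left _ _).trans hx)
      have h2 : Real.exp (u x) ≤ q := Real.exp_le_exp.2 (hbound x hx0)
      have h3 : Real.exp (-(2 * m * x)) * Real.exp (u x) ≤ (1 - q) / 2 := by
        nlinarith [Real.exp_pos (-(2 * m * x)), Real.exp_pos (u x)]
      rw [heq x hx0, Real.exp_add, ← mul_add]
      have h4 : Real.exp (u x) - 1 + Real.exp (-(2 * m * x)) * Real.exp (u x)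
          ≤ -((1 - q) / 2) := by linarith
      calc _ ≤ Λ * -((1 - q) / 2) := mul_le_mul_of_nonneg_left h4 hΛ.le
        _ = -c := by simp only [c]; ring
    set d := deriv u Y / c
    have hd : 0 < d := div_pos (hderiv Y hY0) hc
    obtain ⟨z, hz, hslope⟩ := exists_deriv_eq_slope (deriv u) (lt_add_of_pos_right Y hd)
      hddu.continuous.continuousOn hddu.differentiableOn
    have h1 := hdd z hz.1.le
    rw [hslope, add_sub_cancel_left, div_le_iff₀ hd] at h1
    have h2 : c * d = deriv u Y := mul_div_cancel₀ _ hc.ne'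
    have h3 := hderiv (Y + d) (by linarith)
    linarith
  rw [Metric.tendsto_atTop]
  intro ε hε
  obtain ⟨N, hN0, hN⟩ := key ε hε
  refine ⟨N, fun x hx => ?_⟩
  have h1 := hmono.monotoneOn hN0 (hN0.trans hx) hx
  have h2 := hneg x (hN0.trans hx)
  rw [Real.dist_eq, sub_zero, abs_lt]
  constructor <;> linarith
end

section
/- Let Λ > 0 and m > 0. If u₁, u₂ : [0, ∞) → ℝ are C² solutions of u'' = Λ(e^u − 1) + Λe^{−2mx + u} with u₁(0) = u₂(0) and u₁(x) → 0, u₂(x) → 0 as x → ∞, then u₁(x) = u₂(x) for all x ≥ 0; in particular u₁'(0) = u₂'(0). (The difference w = u₁ − u₂ solves w'' = Λ(e^{ξ(x)} + e^{−2mx+ξ(x)})w with a positive coefficient, vanishes at x = 0 and at infinity, so by the maximum principle w ≡ 0.) -/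
open Filter

/-- Maximum principle on the half-line: a continuous function which is nonpositive at `0`, tends to
`0` at infinity and is strictly convex to second order wherever it is positive is nonpositive. -/
theorem nonpos_of_deriv_deriv_pos_of_tendsto_zero {w : ℝ → ℝ} (hw : Continuous w) (h0 : w 0 ≤ 0)
    (hlim : Tendsto w atTop (nhds 0))
    (hpos : ∀ x : ℝ, 0 ≤ x → 0 < w x → 0 < deriv (deriv w) x) {x : ℝ} (hx : 0 ≤ x) :
    w x ≤ 0 := by
  by_contra! hwx
  obtain ⟨R, hR, hxR⟩ := ((hlim.eventually_lt_const hwx).and (eventually_ge_atTop x)).exists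
  obtain ⟨c, hc, hmax⟩ := isCompact_Icc.exists_isMaxOn (Set.nonempty_Icc.2 (hx.trans hxR))
    hw.continuousOn
  have hxc : w x ≤ w c := hmax ⟨hx, hxR⟩
  have hc0 : 0 < c := hc.1.lt_of_ne (by rintro rfl; linarith)
  have hcR : c < R := hc.2.lt_of_ne (by rintro rfl; linarith)
  have hlmax : IsLocalMax w c := hmax.isLocalMax (Icc_mem_nhds hc0 hcR)
  have hd := hpos c hc0.le (hwx.trans_le hxc)
  have hlmin : IsLocalMin w c :=
    isLocalMin_of_deriv_deriv_pos hd hlmax.deriv_eq_zero hw.continuousAt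
  have hconst : w =ᶠ[nhds c] fun _ => w c := by
    filter_upwards [hlmax, hlmin] with y h₁ h₂ using le_antisymm h₁ h₂
  have hzero := hconst.deriv.deriv_eq
  simp at hzero
  exact hd.ne' hzero

/-- Comparison principle for solutions of the domain wall equation on the half-line. -/
theorem sol_le_of_same_value_and_limit {Λ m : ℝ} (hΛ : 0 < Λ)
    {u₁ u₂ : ℝ → ℝ} (hu₁ : ContDiff ℝ 2 u₁) (hu₂ : ContDiff ℝ 2 u₂)
    (heq₁ : ∀ x : ℝ, 0 ≤ x → deriv (deriv u₁) x =
      Λ * (Real.exp (u₁ x) - 1) + Λ * Real.exp (-(2 * m * x) + u₁ x))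
    (heq₂ : ∀ x : ℝ, 0 ≤ x → deriv (deriv u₂) x =
      Λ * (Real.exp (u₂ x) - 1) + Λ * Real.exp (-(2 * m * x) + u₂ x))
    (h0 : u₁ 0 = u₂ 0)
    (hlim₁ : Tendsto u₁ atTop (nhds 0)) (hlim₂ : Tendsto u₂ atTop (nhds 0))
    {x : ℝ} (hx : 0 ≤ x) : u₁ x ≤ u₂ x := by
  have hd₁ : Differentiable ℝ u₁ := hu₁.differentiable (by norm_num)
  have hd₂ : Differentiable ℝ u₂ := hu₂.differentiable (by norm_num)
  have hdd₁ : Differentiable ℝ (deriv u₁) := hu₁.differentiable_deriv_two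
  have hdd₂ : Differentiable ℝ (deriv u₂) := hu₂.differentiable_deriv_two
  have hderiv : deriv (u₁ - u₂) = deriv u₁ - deriv u₂ :=
    funext fun y => deriv_sub (hd₁ y) (hd₂ y)
  refine sub_nonpos.1 (nonpos_of_deriv_deriv_pos_of_tendsto_zero (w := u₁ - u₂)
    (hu₁.continuous.sub hu₂.continuous) (by simp [h0]) (sub_zero (0 : ℝ) ▸ hlim₁.sub hlim₂) ?_ hx)
  intro y hy hwy
  have hlt : u₂ y < u₁ y := sub_pos.1 hwy
  rw [hderiv, deriv_sub (hdd₁ y) (hdd₂ y), heq₁ y hy, heq₂ y hy, sub_pos]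
  gcongr

/-- Lemma 5: Two `C²` solutions of `u'' = Λ(eᵘ − 1) + Λe^{−2mx+u}` on
`[0, ∞)` with the same initial value and both tending to `0` at `+∞` coincide on
`[0, ∞)`; in particular their initial slopes agree. -/
theorem sol_unique_of_same_value_and_limit (Λ m : ℝ) (hΛ : 0 < Λ) (hm : 0 < m)
    (u₁ u₂ : ℝ → ℝ) (hu₁ : ContDiff ℝ 2 u₁) (hu₂ : ContDiff ℝ 2 u₂)
    (heq₁ : ∀ x : ℝ, 0 ≤ x → deriv (deriv u₁) x =
      Λ * (Real.exp (u₁ x) - 1) + Λ * Real.exp (-(2 * m * x) + u₁ x))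
    (heq₂ : ∀ x : ℝ, 0 ≤ x → deriv (deriv u₂) x =
      Λ * (Real.exp (u₂ x) - 1) + Λ * Real.exp (-(2 * m * x) + u₂ x))
    (h0 : u₁ 0 = u₂ 0)
    (hlim₁ : Tendsto u₁ atTop (nhds 0)) (hlim₂ : Tendsto u₂ atTop (nhds 0)) :
    (∀ x : ℝ, 0 ≤ x → u₁ x = u₂ x) ∧ deriv u₁ 0 = deriv u₂ 0 := by
  have heq : ∀ x : ℝ, 0 ≤ x → u₁ x = u₂ x := fun x hx => le_antisymm
    (sol_le_of_same_value_and_limit hΛ hu₁ hu₂ heq₁ heq₂ h0 hlim₁ hlim₂ hx)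
    (sol_le_of_same_value_and_limit hΛ hu₂ hu₁ heq₂ heq₁ h0.symm hlim₂ hlim₁ hx)
  refine ⟨heq, ?_⟩
  have hd₁ : DifferentiableAt ℝ u₁ 0 := hu₁.differentiable (by norm_num) 0
  have hd₂ : DifferentiableAt ℝ u₂ 0 := hu₂.differentiable (by norm_num) 0
  have huniq : UniqueDiffWithinAt ℝ (Set.Ici (0 : ℝ)) 0 := uniqueDiffWithinAt_Ici 0
  rw [← hd₁.derivWithin huniq, ← hd₂.derivWithin huniq]
  exact derivWithin_congr heq h0
end

section
/- Let Λ > 0 and m > 0, and let u : [0, ∞) → ℝ be a C² solution of u'' = Λ(e^u − 1) + Λe^{−2mx + u} with u(x) < 0 and u'(x) > 0 for all x ≥ 0 and u(x) → 0 as x → ∞. Set μ = min{√Λ, 2m}. Then for every ε ∈ (0, 1) there exists a constant C = C(ε) > 0 such that for all x ≥ 0: 0 > u(x) ≥ −C e^{−μ(1−ε)x} and 0 < u'(x) ≤ C e^{−μ(1−ε)x}. -/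
open Filter

/-- A function with nonnegative derivative on `[X, ∞)` is monotone there. -/
theorem monotoneOn_Ici_of_hasDerivAt_nonneg {f f' : ℝ → ℝ} {X : ℝ}
    (hf : ∀ x, X ≤ x → HasDerivAt f (f' x) x) (hf' : ∀ x, X ≤ x → 0 ≤ f' x) :
    MonotoneOn f (Set.Ici X) := by
  refine monotoneOn_of_hasDerivWithinAt_nonneg (f' := f') (convex_Ici X)
    (fun x hx => (hf x hx).continuousAt.continuousWithinAt) ?_ ?_
  · intro x hx
    exact (hf x (interior_subset hx)).hasDerivWithinAt
  · intro x hx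
    exact hf' x (interior_subset hx)

theorem hasDerivAt_exp_const_mul (k x : ℝ) :
    HasDerivAt (fun y => Real.exp (k * y)) (k * Real.exp (k * x)) x := by
  have h := ((hasDerivAt_id x).const_mul k).exp
  simpa [mul_comm] using h

/-- Linear comparison for `1 - eᵗ` with `t` slightly negative, with a slope below one. -/
theorem exp_sub_one_le_mul {q t : ℝ} (ht : t ≤ 0) (h1 : -1 ≤ t) (hq : q - 1 ≤ t) :
    Real.exp t - 1 ≤ q * t := by
  have h := Real.abs_exp_sub_one_sub_id_le (x := t) (abs_le.2 ⟨h1, by linarith⟩)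
  have h2 := (abs_le.1 h).2
  nlinarith

/-- If an increasing nonpositive `u` tends to zero and `u'' ≤ a² u + L e^{-bx}` near infinity with
`0 < a < b`, then `u` decays at least like `e^{-ax}`. -/
theorem exists_neg_le_mul_exp {u v w : ℝ → ℝ} {a b L X : ℝ} (ha : 0 < a) (hab : a < b)
    (hL : 0 ≤ L) (hu : ∀ x, X ≤ x → HasDerivAt u (v x) x)
    (hv : ∀ x, X ≤ x → HasDerivAt v (w x) x)
    (hw : ∀ x, X ≤ x → w x ≤ a ^ 2 * u x + L * Real.exp (-b * x))
    (hu0 : ∀ x, X ≤ x → u x ≤ 0) (hv0 : ∀ x, X ≤ x → 0 ≤ v x)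
    (hlim : Tendsto u atTop (nhds 0)) (hX : 0 ≤ X) :
    ∃ C : ℝ, ∀ x, X ≤ x → -u x ≤ C * Real.exp (-a * x) := by
  set c := L / (b + a) with hc
  have hcL : c * (b + a) = L := div_mul_cancel₀ _ (by linarith)
  have hc0 : 0 ≤ c := div_nonneg hL (by linarith)
  have hG := monotoneOn_Ici_of_hasDerivAt_nonneg (X := X)
    (f := fun x => -(v x + a * u x) * Real.exp (-a * x) - c * Real.exp (-(b + a) * x))
    (fun x hx => ((((hv x hx).add ((hu x hx).const_mul a)).neg.mul
      (hasDerivAt_exp_const_mul (-a) x)).sub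
        ((hasDerivAt_exp_const_mul (-(b + a)) x).const_mul c))) (by
      intro x hx
      have he : Real.exp (-(b + a) * x) = Real.exp (-b * x) * Real.exp (-a * x) := by
        rw [← Real.exp_add]; ring_nf
      have h := mul_nonneg (sub_nonneg.2 (hw x hx)) (Real.exp_pos (-a * x)).le
      simp only [Pi.add_apply, Pi.neg_apply, he]
      rw [← hcL] at h
      linarith)
  have hz : ∀ x, X ≤ x → -(v x + a * u x) ≤ c * Real.exp (-b * x) := by
    intro x hx
    have hle : -(v x + a * u x) * Real.exp (-a * x) - c * Real.exp (-(b + a) * x) ≤ 0 := by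
      have ht : Tendsto (fun y => -a * u y) atTop (nhds 0) := by
        simpa using hlim.const_mul (-a)
      refine ge_of_tendsto ht ?_
      filter_upwards [eventually_ge_atTop x] with y hy
      have hXy := hx.trans hy
      refine (hG hx hXy hy).trans ?_
      have e1 : Real.exp (-a * y) ≤ 1 := Real.exp_le_one_iff.2 (by nlinarith)
      have e2 : 0 ≤ c * Real.exp (-(b + a) * y) := by positivity
      have e3 : 0 ≤ v y * Real.exp (-a * y) := mul_nonneg (hv0 y hXy) (Real.exp_pos _).le
      have e4 : 0 ≤ (a * -u y) * (1 - Real.exp (-a * y)) :=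
        mul_nonneg (mul_nonneg ha.le (neg_nonneg.2 (hu0 y hXy))) (by linarith)
      simp only
      linarith
    have he : Real.exp (-(b + a) * x) = Real.exp (-b * x) * Real.exp (-a * x) := by
      rw [← Real.exp_add]; ring_nf
    rw [he, ← mul_assoc, ← sub_mul] at hle
    have := nonpos_of_mul_nonpos_left hle (Real.exp_pos _)
    linarith
  set d := c / (b - a) with hd
  have hdc : d * (b - a) = c := div_mul_cancel₀ _ (by linarith)
  have hd0 : 0 ≤ d := div_nonneg hc0 (by linarith)
  have hF := monotoneOn_Ici_of_hasDerivAt_nonneg (X := X)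
    (f := fun x => u x * Real.exp (a * x) - d * Real.exp ((a - b) * x))
    (fun x hx => (((hu x hx).mul (hasDerivAt_exp_const_mul a x)).sub
      ((hasDerivAt_exp_const_mul (a - b) x).const_mul d))) (by
      intro x hx
      have he : Real.exp ((a - b) * x) = Real.exp (-b * x) * Real.exp (a * x) := by
        rw [← Real.exp_add]; ring_nf
      have h := mul_nonneg (sub_nonneg.2 (hz x hx)) (Real.exp_pos (a * x)).le
      rw [he]
      rw [← hdc] at h
      linarith)
  refine ⟨-(u X * Real.exp (a * X) - d * Real.exp ((a - b) * X)), fun x hx => ?_⟩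
  have h := hF (Set.mem_Ici.2 le_rfl) hx hx
  have e : Real.exp (a * x) * Real.exp (-a * x) = 1 := by
    rw [← Real.exp_add]; simp
  have hpos : 0 ≤ d * Real.exp ((a - b) * x) := by positivity
  simp only at h
  have h2 := mul_le_mul_of_nonneg_right (h.trans (sub_le_self _ hpos)) (Real.exp_pos (-a * x)).le
  rw [mul_assoc (u x), e, mul_one] at h2
  linarith

/-- If `u` is bounded above on `[0, ∞)` and `u'' ≥ -K e^{-ax}` there, then `u' ≤ (K / a) e^{-ax}`. -/
theorem deriv_le_mul_exp_of_bddAbove {u v w : ℝ → ℝ} {a K M : ℝ} (ha : 0 < a) (hK : 0 ≤ K)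
    (hu : ∀ x, 0 ≤ x → HasDerivAt u (v x) x) (hv : ∀ x, 0 ≤ x → HasDerivAt v (w x) x)
    (hw : ∀ x, 0 ≤ x → -(K * Real.exp (-a * x)) ≤ w x) (hM : ∀ x, 0 ≤ x → u x ≤ M)
    {x : ℝ} (hx : 0 ≤ x) : v x ≤ K / a * Real.exp (-a * x) := by
  have hKa : K / a * a = K := div_mul_cancel₀ _ ha.ne'
  have hH := monotoneOn_Ici_of_hasDerivAt_nonneg (X := 0)
    (f := fun x => v x - K / a * Real.exp (-a * x))
    (fun x hx => (hv x hx).sub ((hasDerivAt_exp_const_mul (-a) x).const_mul (K / a))) (by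
      intro x hx
      have h := hw x hx
      rw [← hKa] at h
      linarith)
  by_contra! hlt
  set h := v x - K / a * Real.exp (-a * x) with hh
  have hpos : 0 < h := sub_pos.2 hlt
  have hlin := monotoneOn_Ici_of_hasDerivAt_nonneg (X := x) (f := fun y => u y - h * y)
    (fun y hy => (hu y (hx.trans hy)).sub ((hasDerivAt_id y).const_mul h)) (by
      intro y hy
      have h1 : h ≤ v y - K / a * Real.exp (-a * y) := hH hx (hx.trans hy) hy
      have h2 : 0 ≤ K / a * Real.exp (-a * y) := by positivity
      linarith)
  set s := (|M - u x| + 1) / h with hs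
  have hsh : h * s = |M - u x| + 1 := mul_div_cancel₀ _ hpos.ne'
  have hs0 : 0 ≤ s := by positivity
  have h1 := hlin (Set.mem_Ici.2 le_rfl) (Set.mem_Ici.2 (by linarith : x ≤ x + s)) (by linarith)
  have h2 := hM (x + s) (by linarith)
  have h3 := le_abs_self (M - u x)
  simp only at h1
  linarith

/-- Lemma 6: Sharp exponential decay. If `u` is a `C²` solution of
`u'' = Λ(eᵘ − 1) + Λe^{−2mx+u}` on `[0, ∞)` with `u < 0`, `u' > 0` on `[0, ∞)` and
`u(x) → 0` at `+∞`, then with `μ = min{√Λ, 2m}`, for every `ε ∈ (0,1)` there is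
`C > 0` with `0 > u(x) ≥ -C e^{-μ(1-ε)x}` and `0 < u'(x) ≤ C e^{-μ(1-ε)x}` for `x ≥ 0`. -/
theorem sol_exponential_decay (Λ m : ℝ) (hΛ : 0 < Λ) (hm : 0 < m)
    (u : ℝ → ℝ) (hu : ContDiff ℝ 2 u)
    (heq : ∀ x : ℝ, 0 ≤ x → deriv (deriv u) x =
      Λ * (Real.exp (u x) - 1) + Λ * Real.exp (-(2 * m * x) + u x))
    (hneg : ∀ x : ℝ, 0 ≤ x → u x < 0)
    (hderiv : ∀ x : ℝ, 0 ≤ x → 0 < deriv u x)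
    (hlim : Tendsto u atTop (nhds 0)) :
    ∀ ε ∈ Set.Ioo (0 : ℝ) 1, ∃ C : ℝ, 0 < C ∧ ∀ x : ℝ, 0 ≤ x →
      (u x < 0 ∧
        -(C * Real.exp (-(min (Real.sqrt Λ) (2 * m)) * (1 - ε) * x)) ≤ u x ∧
        0 < deriv u x ∧
        deriv u x ≤ C * Real.exp (-(min (Real.sqrt Λ) (2 * m)) * (1 - ε) * x)) := by
  rintro ε ⟨hε0, hε1⟩
  set a := min (Real.sqrt Λ) (2 * m) * (1 - ε) with ha_def
  have hμ : 0 < min (Real.sqrt Λ) (2 * m) := lt_min (Real.sqrt_pos.2 hΛ) (by linarith)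
  have ha : 0 < a := mul_pos hμ (by linarith)
  have haμ : a < min (Real.sqrt Λ) (2 * m) := by nlinarith
  have ham : a < 2 * m := haμ.trans_le (min_le_right _ _)
  have haΛ : a ^ 2 < Λ := (Real.lt_sqrt ha.le).1 (haμ.trans_le (min_le_left _ _))
  have hu1 : ∀ x, HasDerivAt u (deriv u x) x := fun x =>
    (hu.differentiable (by norm_num) x).hasDerivAt
  have hu2 : ∀ x, HasDerivAt (deriv u) (deriv (deriv u) x) x := by
    have h : ContDiff ℝ (1 + 1) u := by norm_num; exact hu
    have h' := (contDiff_succ_iff_deriv.1 h).2.2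
    exact fun x => (h'.differentiable (by norm_num) x).hasDerivAt
  have hq : a ^ 2 / Λ - 1 < 0 := by
    rw [sub_neg, div_lt_one hΛ]; exact haΛ
  obtain ⟨X, hX⟩ := eventually_atTop.1 ((hlim.eventually_const_le (by norm_num : (-1 : ℝ) < 0)).and
    ((hlim.eventually_const_le hq).and (eventually_ge_atTop 0)))
  have hX0 : 0 ≤ X := (hX X le_rfl).2.2
  obtain ⟨C, hC⟩ := exists_neg_le_mul_exp (X := X) ha ham hΛ.le (fun x _ => hu1 x)
    (fun x _ => hu2 x) (by
      intro x hx
      obtain ⟨h1, h2, h0⟩ := hX x hx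
      have hn := hneg x h0
      have h3 := mul_le_mul_of_nonneg_left (exp_sub_one_le_mul hn.le h1 h2) hΛ.le
      rw [← mul_assoc, mul_div_cancel₀ _ hΛ.ne'] at h3
      rw [heq x h0]
      have h4 : Real.exp (-(2 * m * x) + u x) ≤ Real.exp (-(2 * m) * x) :=
        Real.exp_le_exp.2 (by linarith)
      have h5 := mul_le_mul_of_nonneg_left h4 hΛ.le
      linarith) (fun x hx => (hneg x (hX0.trans hx)).le)
    (fun x hx => (hderiv x (hX0.trans hx)).le) hlim hX0
  set D := max C (-u 0 * Real.exp (a * X)) with hD_def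
  have hD : 0 < D := lt_max_of_lt_right
    (mul_pos (neg_pos.2 (hneg 0 le_rfl)) (Real.exp_pos _))
  have hDu : ∀ x, 0 ≤ x → -u x ≤ D * Real.exp (-a * x) := by
    intro x hx
    rcases le_total X x with h | h
    · exact (hC x h).trans
        (mul_le_mul_of_nonneg_right (le_max_left _ _) (Real.exp_pos _).le)
    · have hmono := monotoneOn_Ici_of_hasDerivAt_nonneg (X := 0) (fun x _ => hu1 x)
        (fun x hx => (hderiv x hx).le) (Set.mem_Ici.2 le_rfl) hx hx
      have hle : 1 ≤ Real.exp (a * X) * Real.exp (-a * x) := by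
        rw [← Real.exp_add]
        exact Real.one_le_exp (by nlinarith)
      have h0 := hneg 0 le_rfl
      calc -u x ≤ -u 0 := by linarith
        _ ≤ -u 0 * (Real.exp (a * X) * Real.exp (-a * x)) :=
          le_mul_of_one_le_right (by linarith) hle
        _ = -u 0 * Real.exp (a * X) * Real.exp (-a * x) := by ring
        _ ≤ D * Real.exp (-a * x) :=
          mul_le_mul_of_nonneg_right (le_max_right _ _) (Real.exp_pos _).le
  have hDv : ∀ x, 0 ≤ x → deriv u x ≤ Λ * D / a * Real.exp (-a * x) := by
    intro x hx
    refine deriv_le_mul_exp_of_bddAbove (M := 0) ha (by positivity) (fun x _ => hu1 x)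
      (fun x _ => hu2 x) ?_ (fun x hx => (hneg x hx).le) hx
    intro y hy
    rw [heq y hy]
    have h1 : u y ≤ Real.exp (u y) - 1 := by linarith [Real.add_one_le_exp (u y)]
    have h2 := mul_le_mul_of_nonneg_left h1 hΛ.le
    have h3 := mul_le_mul_of_nonneg_left (hDu y hy) hΛ.le
    have h4 : 0 ≤ Λ * Real.exp (-(2 * m * y) + u y) := by positivity
    linarith
  refine ⟨max D (Λ * D / a), lt_max_of_lt_left hD, fun x hx => ⟨hneg x hx, ?_, hderiv x hx, ?_⟩⟩
  all_goals rw [neg_mul (min _ _), ← ha_def]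
  · rw [neg_le]
    exact (hDu x hx).trans
      (mul_le_mul_of_nonneg_right (le_max_left _ _) (Real.exp_pos _).le)
  · exact (hDv x hx).trans
      (mul_le_mul_of_nonneg_right (le_max_right _ _) (Real.exp_pos _).le)
end
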